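/- Let N_T, N_R, N_U be positive natural numbers, H₁ ∈ ℂ^{N_U×N_T}, H₂ ∈ ℂ^{N_R×N_U} complex matrices, f ≥ 0 and c > 0 real numbers, and K = min(N_T, N_R, N_U). Let a : Fin N_U → ℝ be the eigenvalues of H₁H₁ᴴ in nonincreasing order and b : Fin N_U → ℝ the eigenvalues of H₂ᴴH₂ in nonincreasing order. Then log₂ det(I_{N_T} + c·H₁ᴴH₂ᴴ(f·H₂H₂ᴴ + I_{N_R})⁻¹H₂H₁) ≤ K · log₂(1 + (c/K) · Σ_{i ∈ Fin N_U} aᵢ·bᵢ/(1 + f·bᵢ)). -/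

import Mathlib

open Matrix
open scoped ComplexOrder

lemma aux_trace {n : ℕ} (U V : unitaryGroup (Fin n) ℂ) (α γ : Fin n → ℝ) :
    (trace (((U : Matrix (Fin n) (Fin n) ℂ) * diagonal (fun i => (α i : ℂ)) * star (U : Matrix (Fin n) (Fin n) ℂ)) *
      ((V : Matrix (Fin n) (Fin n) ℂ) * diagonal (fun i => (γ i : ℂ)) * star (V : Matrix (Fin n) (Fin n) ℂ)))).re =
    ∑ i, ∑ j, α i * γ j * Complex.normSq ((star U * V : unitaryGroup (Fin n) ℂ).1 i j) := by
  set W := star U * V with hW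
  have hWc : (W : Matrix (Fin n) (Fin n) ℂ) = star (U : Matrix (Fin n) (Fin n) ℂ) * V := rfl
  have hWs : star (W : Matrix (Fin n) (Fin n) ℂ) = star (V : Matrix (Fin n) (Fin n) ℂ) * U := by
    rw [hWc, star_mul, star_star]
  have : trace (((U : Matrix (Fin n) (Fin n) ℂ) * diagonal (fun i => (α i : ℂ)) * star (U : Matrix (Fin n) (Fin n) ℂ)) *
      ((V : Matrix (Fin n) (Fin n) ℂ) * diagonal (fun i => (γ i : ℂ)) * star (V : Matrix (Fin n) (Fin n) ℂ)))
      = trace ((diagonal (fun i => (α i : ℂ)) * (W : Matrix (Fin n) (Fin n) ℂ)) *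
        (diagonal (fun i => (γ i : ℂ)) * star (W : Matrix (Fin n) (Fin n) ℂ))) := by
    rw [hWs, hWc]
    simp only [mul_assoc]
    rw [trace_mul_comm]
    simp only [mul_assoc]
  rw [this, trace]
  simp only [diag_apply, mul_apply (M := diagonal _ * _), Complex.re_sum]
  refine Finset.sum_congr rfl fun i _ => Finset.sum_congr rfl fun j _ => ?_
  rw [diagonal_mul, diagonal_mul, star_apply]
  have : (α i : ℂ) * W.1 i j * ((γ j : ℂ) * star (W.1 i j)) =
    ((α i * γ j * Complex.normSq (W.1 i j) : ℝ) : ℂ) := by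
    push_cast
    rw [← Complex.mul_conj]
    simp only [Complex.star_def]; ring
  rw [this, Complex.ofReal_re]

lemma aux_ds {n : ℕ} (W : unitaryGroup (Fin n) ℂ) :
    (Matrix.of fun i j => Complex.normSq (W.1 i j)) ∈ doublyStochastic ℝ (Fin n) := by
  rw [mem_doublyStochastic_iff_sum]
  refine ⟨fun i j => Complex.normSq_nonneg _, fun i => ?_, fun j => ?_⟩
  · have h := congrFun (congrFun (mem_unitaryGroup_iff.1 W.2) i) i
    rw [mul_apply, one_apply_eq] at h
    have h2 := congrArg Complex.re h
    rw [Complex.re_sum] at h2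
    simpa [star_apply, Complex.mul_conj] using h2
  · have h := congrFun (congrFun (mem_unitaryGroup_iff'.1 W.2) j) j
    rw [mul_apply, one_apply_eq] at h
    have h2 := congrArg Complex.re h
    rw [Complex.re_sum] at h2
    simpa [star_apply, ← Complex.normSq_eq_conj_mul_self] using h2

lemma aux_rearr {n : ℕ} (D : Matrix (Fin n) (Fin n) ℝ) (hD : D ∈ doublyStochastic ℝ (Fin n))
    (x y : Fin n → ℝ) (s t : Equiv.Perm (Fin n)) (hx : Antitone (x ∘ s)) (hy : Antitone (y ∘ t)) :
    ∑ i, ∑ j, x i * y j * D i j ≤ ∑ i, x (s i) * y (t i) := by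
  obtain ⟨w, hw0, hw1, rfl⟩ := exists_eq_sum_perm_of_mem_doublyStochastic hD
  have key : ∀ p : Equiv.Perm (Fin n), ∑ i, ∑ j, x i * y j * (p.permMatrix ℝ) i j ≤
      ∑ i, x (s i) * y (t i) := by
    intro p
    have h1 : ∑ i, ∑ j, x i * y j * (p.permMatrix ℝ) i j = ∑ i, x i * y (p i) := by
      refine Finset.sum_congr rfl fun i _ => ?_
      simp [Equiv.Perm.permMatrix, PEquiv.toMatrix_apply, eq_comm]
    rw [h1, ← Equiv.sum_comp s]
    have hm : Monovary (x ∘ s) (y ∘ t) := hx.monovary hy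
    have := hm.sum_mul_comp_perm_le_sum_mul (σ := s.trans (p.trans t.symm))
    simpa using this
  calc _ = ∑ p, w p * ∑ i, ∑ j, x i * y j * (p.permMatrix ℝ) i j := by
        simp only [Matrix.sum_apply, Matrix.smul_apply, smul_eq_mul, Finset.mul_sum]
        conv_rhs => rw [Finset.sum_comm]; enter [2, i]; rw [Finset.sum_comm]
        refine Finset.sum_congr rfl fun i _ => Finset.sum_congr rfl fun j _ =>
          Finset.sum_congr rfl fun p _ => by ring
    _ ≤ ∑ p, w p * ∑ i, x (s i) * y (t i) :=
        Finset.sum_le_sum fun p _ => mul_le_mul_of_nonneg_left (key p) (hw0 p)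
    _ = _ := by rw [← Finset.sum_mul, hw1, one_mul]

lemma aux_jensen {n K : ℕ} (hK : 0 < K) (hKn : K ≤ n) (μ : Fin n → ℝ) (h0 : ∀ i, 0 ≤ μ i)
    (hr : (Finset.univ.filter fun i => μ i ≠ 0).card ≤ K) (c : ℝ) (hc : 0 < c) :
    Real.logb 2 (∏ i, (1 + c * μ i)) ≤ K * Real.logb 2 (1 + c / K * ∑ i, μ i) := by
  obtain ⟨S, hS, hcard⟩ := Finset.exists_superset_card_eq hr (by simpa using hKn)
  have hz : ∀ i ∉ S, μ i = 0 := fun i hi => by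
    by_contra h
    exact hi (hS (by simp [h]))
  have hp : ∀ i, 0 < 1 + c * μ i := fun i => by have := h0 i; positivity
  have hK' : (0 : ℝ) < K := by exact_mod_cast hK
  have e1 : ∏ i, (1 + c * μ i) = ∏ i ∈ S, (1 + c * μ i) := by
    symm; apply Finset.prod_subset (Finset.subset_univ _); intro i _ hi; simp [hz i hi]
  have e2 : ∑ i, μ i = ∑ i ∈ S, μ i := by
    symm; apply Finset.sum_subset (Finset.subset_univ _); intro i _ hi; simp [hz i hi]
  have hj := strictConcaveOn_log_Ioi.concaveOn.le_map_sum (t := S) (w := fun _ => (1 / K : ℝ))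
    (p := fun i => 1 + c * μ i) (fun i _ => by positivity)
    (by simp [hcard, hK'.ne']) (fun i _ => hp i)
  simp only [smul_eq_mul, ← Finset.mul_sum] at hj
  have e3 : (1 / K : ℝ) * ∑ i ∈ S, (1 + c * μ i) = 1 + c / K * ∑ i ∈ S, μ i := by
    rw [Finset.sum_add_distrib, ← Finset.mul_sum]
    simp [hcard]; field_simp
  rw [e3] at hj
  rw [e1, e2, Real.logb, Real.logb, Real.log_prod (fun i _ => (hp i).ne'), ← mul_div_assoc]
  have : 0 < Real.log 2 := Real.log_pos (by norm_num)
  gcongr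
  rw [div_mul_eq_mul_div, one_mul, div_le_iff₀ hK'] at hj
  linarith

lemma aux_X {NR NU : ℕ} (H₂ : Matrix (Fin NR) (Fin NU) ℂ) (f : ℝ) (hf : 0 ≤ f)
    (h2 : (H₂ᴴ * H₂).IsHermitian) :
    H₂ᴴ * ((f : ℂ) • (H₂ * H₂ᴴ) + 1)⁻¹ * H₂ =
      (h2.eigenvectorUnitary : Matrix (Fin NU) (Fin NU) ℂ) *
        diagonal (fun i => ((h2.eigenvalues i / (1 + f * h2.eigenvalues i) : ℝ) : ℂ)) *
        star (h2.eigenvectorUnitary : Matrix (Fin NU) (Fin NU) ℂ) := by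
  have hfc : (0 : ℂ) ≤ (f : ℂ) := by exact_mod_cast hf
  have hC : IsUnit ((f : ℂ) • (H₂ * H₂ᴴ) + 1).det := by
    have : ((f : ℂ) • (H₂ * H₂ᴴ) + 1).PosDef :=
      PosDef.posSemidef_add ((posSemidef_self_mul_conjTranspose H₂).smul hfc) PosDef.one
    exact (isUnit_iff_isUnit_det _).1 this.isUnit
  have hB : IsUnit ((f : ℂ) • (H₂ᴴ * H₂) + 1) := by
    have : ((f : ℂ) • (H₂ᴴ * H₂) + 1).PosDef :=
      PosDef.posSemidef_add ((posSemidef_conjTranspose_mul_self H₂).smul hfc) PosDef.one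
    exact this.isUnit
  apply hB.mul_left_cancel
  have e1 : ((f : ℂ) • (H₂ᴴ * H₂) + 1) * (H₂ᴴ * ((f : ℂ) • (H₂ * H₂ᴴ) + 1)⁻¹ * H₂) = H₂ᴴ * H₂ := by
    have : ((f : ℂ) • (H₂ᴴ * H₂) + 1) * H₂ᴴ = H₂ᴴ * ((f : ℂ) • (H₂ * H₂ᴴ) + 1) := by
      simp [Matrix.add_mul, Matrix.mul_add, Matrix.mul_assoc]
    rw [← Matrix.mul_assoc, ← Matrix.mul_assoc, this, Matrix.mul_assoc H₂ᴴ,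
      mul_nonsing_inv _ hC, Matrix.mul_one]
  rw [e1]
  have h0 : ∀ i, 0 ≤ h2.eigenvalues i := (posSemidef_conjTranspose_mul_self H₂).eigenvalues_nonneg
  have hs := h2.spectral_theorem
  rw [Unitary.conjStarAlgAut_apply] at hs
  generalize hV : (h2.eigenvectorUnitary : Matrix (Fin NU) (Fin NU) ℂ) = V at hs ⊢
  have hV1 : star V * V = 1 := by rw [← hV]; simp
  have hV2 : V * star V = 1 := by rw [← hV]; simp
  have e2 : (f : ℂ) • (H₂ᴴ * H₂) + 1 =
      V * diagonal (fun i => ((1 + f * h2.eigenvalues i : ℝ) : ℂ)) * star V := by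
    have : diagonal (fun i => ((1 + f * h2.eigenvalues i : ℝ) : ℂ)) =
      1 + (f : ℂ) • diagonal (RCLike.ofReal ∘ h2.eigenvalues : Fin NU → ℂ) := by
      ext i j
      by_cases h : i = j
      · subst h; simp
      · simp [h]
    rw [this, Matrix.mul_add, Matrix.add_mul, Matrix.mul_one, hV2, Matrix.mul_smul, Matrix.smul_mul, ← hs, add_comm]
  rw [e2]
  conv_lhs => rw [hs]
  have : ∀ D E : Matrix (Fin NU) (Fin NU) ℂ, V * D * star V * (V * E * star V) = V * (D * E) * star V := by
    intro D E
    calc _ = V * D * (star V * V) * E * star V := by simp only [Matrix.mul_assoc]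
      _ = _ := by rw [hV1]; simp only [Matrix.mul_assoc, Matrix.one_mul]
  rw [this, diagonal_mul_diagonal]
  congr 3
  funext i
  have : 1 + f * h2.eigenvalues i ≠ 0 := by have := h0 i; positivity
  rw [← Complex.ofReal_mul, mul_div_cancel₀ _ this]; rfl

theorem relay_capacity_singular_value_bound (NT NR NU : ℕ)
    (hT : 0 < NT) (hR : 0 < NR) (hU : 0 < NU)
    (H₁ : Matrix (Fin NU) (Fin NT) ℂ) (H₂ : Matrix (Fin NR) (Fin NU) ℂ)
    (f c : ℝ) (hf : 0 ≤ f) (hc : 0 < c)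
    (h1 : (H₁ * H₁ᴴ).IsHermitian) (h2 : (H₂ᴴ * H₂).IsHermitian)
    (a b : Fin NU → ℝ) (ha_mono : Antitone a) (hb_mono : Antitone b)
    (ha : ∃ σ : Equiv.Perm (Fin NU), a = h1.eigenvalues ∘ σ)
    (hb : ∃ σ : Equiv.Perm (Fin NU), b = h2.eigenvalues ∘ σ) :
    Real.logb 2
        ((1 + (c : ℂ) •
          (H₁ᴴ * H₂ᴴ * ((f : ℂ) • (H₂ * H₂ᴴ) + 1)⁻¹ * H₂ * H₁)).det).re ≤
      (min NT (min NR NU) : ℝ) *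
        Real.logb 2 (1 + c / (min NT (min NR NU) : ℝ) *
          ∑ i, a i * b i / (1 + f * b i)) := by
  have hK : 0 < min NT (min NR NU) := by simp [hT, hR, hU]
  have hcast : (min NT (min NR NU) : ℝ) = ((min NT (min NR NU) : ℕ) : ℝ) := by push_cast; rfl
  rw [hcast]
  have hb0 : ∀ i, 0 ≤ b i := by
    obtain ⟨t, rfl⟩ := hb
    exact fun i => (posSemidef_conjTranspose_mul_self H₂).eigenvalues_nonneg _
  set M := H₁ᴴ * H₂ᴴ * ((f : ℂ) • (H₂ * H₂ᴴ) + 1)⁻¹ * H₂ * H₁ with hM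
  have hfc : (0 : ℂ) ≤ (f : ℂ) := by exact_mod_cast hf
  have hMX : M = H₁ᴴ * (H₂ᴴ * ((f : ℂ) • (H₂ * H₂ᴴ) + 1)⁻¹ * H₂) * H₁ := by
    simp only [hM, Matrix.mul_assoc]
  have hCps : ((f : ℂ) • (H₂ * H₂ᴴ) + 1).PosDef :=
      PosDef.posSemidef_add ((posSemidef_self_mul_conjTranspose H₂).smul hfc) PosDef.one
  have hMps : M.PosSemidef := by
    rw [hMX]
    exact (hCps.inv.posSemidef.conjTranspose_mul_mul_same H₂).conjTranspose_mul_mul_same H₁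
  have hMh := hMps.isHermitian
  have htr : ∑ i, hMh.eigenvalues i ≤ ∑ i, a i * b i / (1 + f * b i) := by
    have e : ∑ i, hMh.eigenvalues i = (trace M).re := by
      rw [hMh.trace_eq_sum_eigenvalues, Complex.re_sum]; rfl
    have hs := h1.spectral_theorem
    rw [Unitary.conjStarAlgAut_apply] at hs
    have e2 : trace M = trace ((H₁ * H₁ᴴ) * (H₂ᴴ * ((f : ℂ) • (H₂ * H₂ᴴ) + 1)⁻¹ * H₂)) := by
      rw [hMX, trace_mul_comm, ← Matrix.mul_assoc]
    rw [e, e2, aux_X H₂ f hf h2, hs]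
    refine (aux_trace h1.eigenvectorUnitary h2.eigenvectorUnitary h1.eigenvalues
      (fun i => h2.eigenvalues i / (1 + f * h2.eigenvalues i))).trans_le ?_
    obtain ⟨s, rfl⟩ := ha
    obtain ⟨t, rfl⟩ := hb
    refine (aux_rearr _ (aux_ds (star h1.eigenvectorUnitary * h2.eigenvectorUnitary)) h1.eigenvalues
      (fun i => h2.eigenvalues i / (1 + f * h2.eigenvalues i)) s t ha_mono ?_).trans_eq ?_
    · intro i j hij
      have h3 := hb_mono hij
      have h4 := hb0 i
      have h5 := hb0 j
      simp only [Function.comp] at h3 h4 h5 ⊢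
      rw [div_le_div_iff₀ (by positivity) (by positivity)]
      nlinarith
    · exact Finset.sum_congr rfl fun i _ => by simp [mul_div_assoc]
  have hrank : (Finset.univ.filter fun i => hMh.eigenvalues i ≠ 0).card ≤ min NT (min NR NU) := by
    rw [← Fintype.card_subtype, ← hMh.rank_eq_card_non_zero_eigs]
    refine le_min ?_ (le_min ?_ ?_)
    · simpa using M.rank_le_card_width
    · rw [hM, Matrix.mul_assoc _ H₂]
      refine (rank_mul_le_right _ _).trans ((rank_mul_le_left _ _).trans ?_)
      simpa using H₂.rank_le_card_height
    · refine (rank_mul_le_right _ _).trans ?_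
      simpa using H₁.rank_le_card_height
  have hdet : ((1 + (c : ℂ) • M).det).re = ∏ i, (1 + c * hMh.eigenvalues i) := by
    have hs := hMh.spectral_theorem
    rw [Unitary.conjStarAlgAut_apply] at hs
    generalize hV : (hMh.eigenvectorUnitary : Matrix (Fin NT) (Fin NT) ℂ) = V at hs
    have hV1 : star V * V = 1 := by rw [← hV]; simp
    have hV2 : V * star V = 1 := by rw [← hV]; simp
    have : 1 + (c : ℂ) • M =
      V * diagonal (fun i => ((1 + c * hMh.eigenvalues i : ℝ) : ℂ)) * star V := by
      have : diagonal (fun i => ((1 + c * hMh.eigenvalues i : ℝ) : ℂ)) =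
        1 + (c : ℂ) • diagonal (RCLike.ofReal ∘ hMh.eigenvalues : Fin NT → ℂ) := by
        ext i j
        by_cases h : i = j
        · subst h; simp
        · simp [h]
      rw [this, Matrix.mul_add, Matrix.add_mul, Matrix.mul_one, hV2, Matrix.mul_smul,
        Matrix.smul_mul, ← hs]
    rw [this, det_mul_comm, ← Matrix.mul_assoc, hV1, Matrix.one_mul, det_diagonal,
      ← Complex.ofReal_prod, Complex.ofReal_re]
  rw [hdet]
  refine (aux_jensen hK (min_le_left _ _) _ hMps.eigenvalues_nonneg hrank c hc).trans ?_
  have hK' : (0 : ℝ) < ((min NT (min NR NU) : ℕ) : ℝ) := by exact_mod_cast hK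
  have h0 : 0 ≤ ∑ i, hMh.eigenvalues i := Finset.sum_nonneg fun i _ => hMps.eigenvalues_nonneg i
  apply mul_le_mul_of_nonneg_left _ hK'.le
  apply Real.logb_le_logb_of_le (by norm_num) (by positivity)
  gcongr
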